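/- arXiv:1912.02555 — 2 statements merged into one kernel-verified Lean document; each statement's English description precedes it below -/
import Mathlib

section
/- Let G be a group, let u, v ∈ G, and let q be an element of the center of G such that v·u = q·(u·v). For integers a, b, c, d set u' = u^a·v^c and v' = u^b·v^d. Then v'·u' = q^{ad−bc}·(u'·v'). -/
/-- Commutation of integer powers of two elements that commute up to a central factor. -/
theorem zpow_mul_zpow_of_mul_eq_central_mul {G : Type*} [Group G] {u v q : G}
    (hq : q ∈ Subgroup.center G) (h : v * u = q * (u * v)) (m n : ℤ) :
    v ^ n * u ^ m = q ^ (m * n) * (u ^ m * v ^ n) := by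
  have hc : ∀ (k : ℤ) (g : G), Commute (q ^ k) g := fun k g =>
    (Subgroup.mem_center_iff.mp (Subgroup.zpow_mem _ hq k) g).symm
  have hqu : Commute q u := (Subgroup.mem_center_iff.mp hq u).symm
  have hv : SemiconjBy v u (q * u) := by rw [SemiconjBy, h, mul_assoc]
  have hm : v * u ^ m = q ^ m * u ^ m * v := by
    rw [← hqu.mul_zpow]
    exact hv.zpow_right m
  have hu : SemiconjBy (u ^ m) (q ^ m * v) v := by
    rw [SemiconjBy, hm, ← mul_assoc, (hc m (u ^ m)).eq]
  have hn : u ^ m * (q ^ m * v) ^ n = v ^ n * u ^ m := hu.zpow_right n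
  rw [← hn, (hc m v).mul_zpow, ← zpow_mul, ← mul_assoc, ← (hc (m * n) (u ^ m)).eq, mul_assoc]

theorem weyl_relation_sl2_transform {G : Type*} [Group G] (u v q : G)
    (hq : q ∈ Subgroup.center G) (h : v * u = q * (u * v)) (a b c d : ℤ) :
    (u ^ b * v ^ d) * (u ^ a * v ^ c) =
      q ^ (a * d - b * c) * ((u ^ a * v ^ c) * (u ^ b * v ^ d)) := by
  have hc : ∀ (k : ℤ) (g : G), q ^ k * g = g * q ^ k := fun k g =>
    (Subgroup.mem_center_iff.mp (Subgroup.zpow_mem _ hq k) g).symm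
  calc (u ^ b * v ^ d) * (u ^ a * v ^ c)
      = u ^ b * (v ^ d * u ^ a) * v ^ c := by group
    _ = q ^ (a * d) * (u ^ a * u ^ b * (v ^ c * v ^ d)) := by
        rw [zpow_mul_zpow_of_mul_eq_central_mul hq h, ← mul_assoc (u ^ b), ← hc,
          (Commute.refl u).zpow_zpow a b |>.eq, (Commute.refl v).zpow_zpow c d |>.eq]
        simp only [mul_assoc]
    _ = q ^ (a * d - b * c) * (q ^ (b * c) * u ^ a * (u ^ b * v ^ c) * v ^ d) := by
        rw [← sub_add_cancel (a * d) (b * c), zpow_add, add_sub_cancel_right]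
        simp only [mul_assoc]
    _ = q ^ (a * d - b * c) * (u ^ a * (v ^ c * u ^ b) * v ^ d) := by
        rw [zpow_mul_zpow_of_mul_eq_central_mul hq h, hc (b * c) (u ^ a)]
        simp only [mul_assoc]
    _ = q ^ (a * d - b * c) * ((u ^ a * v ^ c) * (u ^ b * v ^ d)) := by
        simp only [mul_assoc]
end

section
/- Let A be a unital algebra over the complex numbers, let U and V be units of A, and let θ be a real number such that V·U = exp(2πiθ)·(U·V) in A. For integers a, b, c, d define U' = exp(πiac)·U^a·V^c and V' = exp(πibd)·U^b·V^d (integer powers taken in the group of units of A, scalar multiplication by complex exponentials). Then V'·U' = exp(2πiθ(ad−bc))·(U'·V'). -/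
open Complex

/-- If `v * u = z * (u * v)` with `z` commuting with `u` and `v`, then integer powers of `u` and `v`
commute up to the corresponding power of `z`. -/
theorem zpow_mul_zpow_of_commute_up_to {G : Type*} [Group G] {u v z : G}
    (hu : Commute z u) (hv : Commute z v) (h : v * u = z * (u * v)) (m n : ℤ) :
    v ^ n * u ^ m = z ^ (m * n) * (u ^ m * v ^ n) := by
  have h₁ : SemiconjBy v (u ^ m) (z ^ m * u ^ m) := by
    rw [← hu.mul_zpow]
    exact SemiconjBy.zpow_right (show v * u = z * u * v by rw [h, mul_assoc]) m
  have h₂ : SemiconjBy (u ^ m) (z ^ m * v) v := by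
    change u ^ m * (z ^ m * v) = v * u ^ m
    rw [h₁.eq, ← mul_assoc, (hu.zpow_zpow m m).eq]
  have h₃ := (h₂.zpow_right n).eq
  rw [(hv.zpow_left m).mul_zpow, ← zpow_mul] at h₃
  rw [← h₃, ← mul_assoc, ← mul_assoc, (hu.zpow_zpow (m * n) m).eq]

/-- Monomials in two elements commuting up to a central `z` commute up to `z` to the power of the
determinant of their exponents. -/
theorem monomial_mul_monomial_of_commute_up_to {G : Type*} [Group G] {u v z : G}
    (hz : ∀ g, Commute z g) (h : v * u = z * (u * v)) (a b c d : ℤ) :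
    (u ^ b * v ^ d) * (u ^ a * v ^ c) =
      z ^ (a * d - b * c) * ((u ^ a * v ^ c) * (u ^ b * v ^ d)) := by
  have key (k l m n : ℤ) :
      (u ^ k * v ^ l) * (u ^ m * v ^ n) = z ^ (m * l) * (u ^ (k + m) * v ^ (l + n)) := by
    calc (u ^ k * v ^ l) * (u ^ m * v ^ n) = u ^ k * (v ^ l * u ^ m) * v ^ n := by group
      _ = (u ^ k * z ^ (m * l)) * (u ^ m * v ^ l) * v ^ n := by
        rw [zpow_mul_zpow_of_commute_up_to (hz u) (hz v) h, ← mul_assoc (u ^ k)]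
      _ = z ^ (m * l) * (u ^ (k + m) * v ^ (l + n)) := by
        rw [← ((hz (u ^ k)).zpow_left (m * l)).eq, zpow_add, zpow_add]
        simp only [mul_assoc]
  rw [key, key, ← mul_assoc (z ^ (a * d - b * c)), ← zpow_add, sub_add_cancel, add_comm b, add_comm d]

theorem noncommutative_torus_transform {A : Type*} [Ring A] [Algebra ℂ A]
    (U V : Aˣ) (θ : ℝ)
    (h : (V : A) * (U : A) = Complex.exp (2 * Real.pi * I * θ) • ((U : A) * (V : A)))
    (a b c d : ℤ) :
    (Complex.exp (Real.pi * I * b * d) • ((U ^ b * V ^ d : Aˣ) : A)) *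
        (Complex.exp (Real.pi * I * a * c) • ((U ^ a * V ^ c : Aˣ) : A)) =
      Complex.exp (2 * Real.pi * I * θ * (a * d - b * c)) •
        ((Complex.exp (Real.pi * I * a * c) • ((U ^ a * V ^ c : Aˣ) : A)) *
          (Complex.exp (Real.pi * I * b * d) • ((U ^ b * V ^ d : Aˣ) : A))) := by
  set z : Aˣ := Units.map (algebraMap ℂ A).toMonoidHom
    (Units.mk0 (Complex.exp (2 * Real.pi * I * θ)) (Complex.exp_ne_zero _)) with hz_def
  have hz (g : Aˣ) : Commute z g := Units.ext (Algebra.commutes _ (g : A))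
  have hVU : V * U = z * (U * V) := Units.ext (by
    simpa [hz_def, Algebra.smul_def] using h)
  have hpow (n : ℤ) :
      ((z ^ n : Aˣ) : A) = algebraMap ℂ A (Complex.exp (2 * Real.pi * I * θ * n)) := by
    rw [hz_def, ← map_zpow, Units.coe_map, Units.val_zpow_eq_zpow_val, Units.val_mk0,
      ← Complex.exp_int_mul, mul_comm (n : ℂ)]
    rfl
  have hmain : ((U ^ b * V ^ d : Aˣ) : A) * ((U ^ a * V ^ c : Aˣ) : A) =
      Complex.exp (2 * Real.pi * I * θ * (a * d - b * c)) •
        (((U ^ a * V ^ c : Aˣ) : A) * ((U ^ b * V ^ d : Aˣ) : A)) := by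
    rw [← Units.val_mul, monomial_mul_monomial_of_commute_up_to hz hVU, Units.val_mul, hpow,
      Algebra.smul_def, Units.val_mul (U ^ a * V ^ c)]
    push_cast
    rfl
  rw [smul_mul_smul_comm, smul_mul_smul_comm, hmain, smul_smul, smul_smul]
  congr 1
  ring
end
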